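/- Let p > 0 and let 𝒮_p ⊆ ℝ³ be the polynomial spiral shell. For every θ ∈ (0,1), the regularized Assouad spectrum of 𝒮_p is given by: if p ≤ 1/2, then dim_{A,reg}^θ 𝒮_p = min{ 3/((1+p)(1−θ)), 3 }; and if p > 1/2, then dim_{A,reg}^θ 𝒮_p = min{ 2 + θ/(p(1−θ)), 3 }. -/

import Mathlib

open Metric Set Filter MeasureTheory Topology
open scoped RealInnerProductSpace

noncomputable section

/-- `d`-dimensional Euclidean space. -/
abbrev Euc (d : ℕ) : Type := EuclideanSpace ℝ (Fin d)

/-- The number of cubes in the axes-oriented `r`-mesh of `ℝ^d` that intersect `E`;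
for nonempty bounded `E` this is the box-counting number `N_r(E)`. -/
def meshCubeCount (d : ℕ) (r : ℝ) (E : Set (Euc d)) : ℕ :=
  Set.ncard {k : Fin d → ℤ | ∃ x ∈ E, ∀ i, (k i : ℝ) * r ≤ x i ∧ x i < ((k i : ℝ) + 1) * r}

/-- The lower box dimension `liminf_{r → 0⁺} log N_r(E) / (- log r)`. -/
def lowerBoxDim (d : ℕ) (E : Set (Euc d)) : ℝ :=
  liminf (fun r : ℝ => Real.log (meshCubeCount d r E : ℝ) / -Real.log r) (𝓝[>] (0 : ℝ))

/-- The upper box dimension `limsup_{r → 0⁺} log N_r(E) / (- log r)`. -/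
def upperBoxDim (d : ℕ) (E : Set (Euc d)) : ℝ :=
  limsup (fun r : ℝ => Real.log (meshCubeCount d r E : ℝ) / -Real.log r) (𝓝[>] (0 : ℝ))

/-- The box dimension of `E` exists and equals `v`. -/
def HasBoxDim (d : ℕ) (E : Set (Euc d)) (v : ℝ) : Prop :=
  lowerBoxDim d E = v ∧ upperBoxDim d E = v

/-- The `θ`-Assouad spectrum of `E ⊆ ℝ^d`. -/
def assouadSpec (d : ℕ) (θ : ℝ) (E : Set (Euc d)) : ℝ :=
  sInf {α : ℝ | 0 < α ∧ ∃ C : ℝ, 0 < C ∧ ∀ r : ℝ, 0 < r → r < 1 → ∀ x ∈ E,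
    (meshCubeCount d r (ball x (r ^ θ) ∩ E) : ℝ) ≤ C * (r ^ (θ - 1)) ^ α}

/-- The regularized (upper) `θ`-Assouad spectrum of `E ⊆ ℝ^d`. -/
def regAssouadSpec (d : ℕ) (θ : ℝ) (E : Set (Euc d)) : ℝ :=
  sInf {α : ℝ | 0 < α ∧ ∃ C : ℝ, 0 < C ∧ ∀ r R : ℝ, 0 < r → 0 < R → r ≤ R ^ (1 / θ) → R < 1 →
    ∀ x ∈ E, (meshCubeCount d r (ball x R ∩ E) : ℝ) ≤ C * (R / r) ^ α}

/-- The Assouad dimension of `E ⊆ ℝ^d`. -/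
def assouadDim (d : ℕ) (E : Set (Euc d)) : ℝ :=
  sInf {α : ℝ | 0 < α ∧ ∃ C : ℝ, 0 < C ∧ ∀ r R : ℝ, 0 < r → r ≤ R → ∀ x ∈ E,
    (meshCubeCount d r (ball x R ∩ E) : ℝ) ≤ C * (R / r) ^ α}

/-- The (Euclidean) distance between two sets. -/
def setDistance {d : ℕ} (A B : Set (Euc d)) : ℝ :=
  sInf (Set.image2 dist A B)

/-- `S ⊆ ℝ^d` is a topological sphere: the image of the unit sphere under a
self-homeomorphism of `ℝ^d`. -/
def IsTopologicalSphere (d : ℕ) (S : Set (Euc d)) : Prop :=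
  ∃ f : Euc d ≃ₜ Euc d, S = f '' sphere (0 : Euc d) 1

/-- `g` is a similarity of `ℝ^d` with similarity ratio `c`, i.e. `g x = c • A x + t`
with `c > 0`, `A` orthogonal and `t ∈ ℝ^d`. -/
def IsSimilarityRatio {d : ℕ} (g : Euc d → Euc d) (c : ℝ) : Prop :=
  0 < c ∧ ∃ A : Euc d ≃ₗᵢ[ℝ] Euc d, ∃ t : Euc d, ∀ x, g x = c • A x + t

/-- `g` is a similarity map of `ℝ^d`. -/
def IsSimilarity {d : ℕ} (g : Euc d → Euc d) : Prop :=
  ∃ c : ℝ, IsSimilarityRatio g c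

/-- `S` is a concentric sphere collection centered at `x₀` and generated by the
topological sphere `S₀`. -/
def IsConcentricSphereColl (d : ℕ) (x₀ : Euc d) (S₀ S : Set (Euc d)) : Prop :=
  ∃ f : Euc d ≃ₜ Euc d, S₀ = f '' sphere (0 : Euc d) 1 ∧ x₀ ∈ f '' ball (0 : Euc d) 1 ∧
    ∃ g : ℕ → Euc d → Euc d, g 0 = id ∧ (∀ n, IsSimilarity (g n)) ∧
      S = (⋃ n : ℕ, g n '' S₀) ∧
      ∃ c₁ c₂ : ℝ, ∃ n₀ : ℕ, ∃ a : ℕ → ℝ,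
        c₁ ∈ Ioc (0 : ℝ) 1 ∧ c₂ ∈ Ioc (0 : ℝ) 1 ∧ 1 ≤ n₀ ∧
        StrictAnti a ∧ Tendsto a atTop (𝓝 (0 : ℝ)) ∧
        ∀ n : ℕ, n₀ ≤ n →
          hausdorffDist (g n '' S₀) {x₀} = c₁ * a n ∧
          setDistance (g n '' S₀) (g (n + 1) '' S₀) = c₂ * (a n - a (n + 1))

/-- `S` is a `p`-polynomially concentric sphere collection centered at `x₀` and generated
by the topological sphere `S₀` (the defining sequence is `a n = n ^ (-p)`). -/
def IsPConcentricSphereColl (d : ℕ) (p : ℝ) (x₀ : Euc d) (S₀ S : Set (Euc d)) : Prop :=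
  ∃ f : Euc d ≃ₜ Euc d, S₀ = f '' sphere (0 : Euc d) 1 ∧ x₀ ∈ f '' ball (0 : Euc d) 1 ∧
    ∃ g : ℕ → Euc d → Euc d, g 0 = id ∧ (∀ n, IsSimilarity (g n)) ∧
      S = (⋃ n : ℕ, g n '' S₀) ∧
      ∃ c₁ c₂ : ℝ, ∃ n₀ : ℕ, ∃ a : ℕ → ℝ,
        c₁ ∈ Ioc (0 : ℝ) 1 ∧ c₂ ∈ Ioc (0 : ℝ) 1 ∧ 1 ≤ n₀ ∧
        StrictAnti a ∧ Tendsto a atTop (𝓝 (0 : ℝ)) ∧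
        (∀ n : ℕ, n₀ ≤ n → a n = (n : ℝ) ^ (-p)) ∧
        ∀ n : ℕ, n₀ ≤ n →
          hausdorffDist (g n '' S₀) {x₀} = c₁ * a n ∧
          setDistance (g n '' S₀) (g (n + 1) '' S₀) = c₂ * (a n - a (n + 1))

/-- The polynomial spiral shell `𝒮_p ⊆ ℝ³`. -/
def spiralShell (p : ℝ) : Set (Euc 3) :=
  {x : Euc 3 | ∃ u v : ℝ, 1 ≤ u ∧ 1 ≤ v ∧
    x = (WithLp.equiv 2 (Fin 3 → ℝ)).symm
      ![u ^ (-p) * Real.cos u * Real.sin v,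
        u ^ (-p) * Real.sin u * Real.sin v,
        u ^ (-p) * Real.cos v]}

/-- The union `⋃_{j ≥ 1} S(0, j^{-p})` of concentric round spheres in `ℝ³`. -/
def sphereUnion (p : ℝ) : Set (Euc 3) :=
  ⋃ j : ℕ, sphere (0 : Euc 3) (((j : ℝ) + 1) ^ (-p))

/-- `F : ℝ³ → ℝ³` is `K`-quasiconformal: `F` lies in the local Sobolev space
`W^{1,3}_loc(ℝ³; ℝ³)`, witnessed by a weak differential `DF` which is locally `L³`
(integrable on every ball) and satisfies the integration-by-parts identity against every
smooth compactly supported test function, and `|DF|³ ≤ K · det DF` almost everywhere. -/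
def IsQuasiconformal (K : ℝ) (F : Euc 3 → Euc 3) : Prop :=
  ∃ DF : Euc 3 → Euc 3 →L[ℝ] Euc 3,
    (∀ R : ℝ, 0 < R → IntegrableOn (fun x => ‖DF x‖ ^ (3 : ℕ)) (ball (0 : Euc 3) R) volume) ∧
    (∀ φ : Euc 3 → ℝ, ContDiff ℝ (⊤ : ℕ∞) φ → HasCompactSupport φ → ∀ v w : Euc 3,
      ∫ x, fderiv ℝ φ x v * ⟪F x, w⟫ = - ∫ x, φ x * ⟪DF x v, w⟫) ∧
    ∀ᵐ x ∂(volume : Measure (Euc 3)), ‖DF x‖ ^ (3 : ℕ) ≤ K * (DF x).det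

/-- The index of the mesh cube of side `r` that contains `x`. -/
def meshIndex (d : ℕ) (r : ℝ) (x : Euc d) : Fin d → ℤ := fun i => ⌊x i / r⌋

lemma meshCubeCount_eq_ncard_image {d : ℕ} {r : ℝ} (hr : 0 < r) (E : Set (Euc d)) :
    meshCubeCount d r E = (meshIndex d r '' E).ncard := by
  unfold meshCubeCount
  congr 1
  ext k
  simp only [mem_ofPred_eq, mem_image]
  refine exists_congr fun x => and_congr_right fun _ => ?_
  rw [funext_iff]
  refine forall_congr' fun i => ?_
  rw [meshIndex, Int.floor_eq_iff, le_div_iff₀ hr, div_lt_iff₀ hr]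

lemma meshIndex_image_ball_subset {d : ℕ} {r R : ℝ} (hr : 0 < r) (x : Euc d) :
    meshIndex d r '' ball x R ⊆
      Icc (fun i => ⌊(x i - R) / r⌋) (fun i => ⌊(x i + R) / r⌋) := by
  rintro _ ⟨y, hy, rfl⟩
  have h : ∀ i, |y i - x i| < R := fun i => by
    have := PiLp.norm_apply_le (y - x) i
    rw [mem_ball, dist_eq_norm] at hy
    simpa using this.trans_lt hy
  constructor <;> intro i <;> have := abs_lt.1 (h i) <;>
    · simp only [meshIndex]
      gcongr
      linarith

lemma finite_meshIndex_image {d : ℕ} {r : ℝ} (hr : 0 < r) {E : Set (Euc d)}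
    (hE : Bornology.IsBounded E) : (meshIndex d r '' E).Finite := by
  obtain ⟨R, hR⟩ := hE.subset_ball 0
  exact (Set.finite_Icc _ _).subset ((image_mono hR).trans (meshIndex_image_ball_subset hr 0))

lemma meshCubeCount_mono {d : ℕ} {r : ℝ} (hr : 0 < r) {E F : Set (Euc d)} (h : E ⊆ F)
    (hF : Bornology.IsBounded F) : meshCubeCount d r E ≤ meshCubeCount d r F := by
  rw [meshCubeCount_eq_ncard_image hr, meshCubeCount_eq_ncard_image hr]
  exact Set.ncard_le_ncard (image_mono h) (finite_meshIndex_image hr hF)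

lemma meshCubeCount_union_le {d : ℕ} {r : ℝ} (hr : 0 < r) (E F : Set (Euc d)) :
    meshCubeCount d r (E ∪ F) ≤ meshCubeCount d r E + meshCubeCount d r F := by
  simp only [meshCubeCount_eq_ncard_image hr, image_union]
  exact Set.ncard_union_le _ _

lemma meshCubeCount_biUnion_le {d : ℕ} {r : ℝ} (hr : 0 < r) {ι : Type*} (T : Finset ι)
    (A : ι → Set (Euc d)) :
    meshCubeCount d r (⋃ t ∈ T, A t) ≤ ∑ t ∈ T, meshCubeCount d r (A t) := by
  simp only [meshCubeCount_eq_ncard_image hr, image_iUnion]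
  exact Finset.set_ncard_biUnion_le _ _

lemma meshCubeCount_ball_le {r R : ℝ} (hr : 0 < r) (hR : r ≤ R) (x : Euc 3) :
    (meshCubeCount 3 r (ball x R) : ℝ) ≤ 64 * (R / r) ^ 3 := by
  have h1 : 1 ≤ R / r := (one_le_div hr).2 hR
  have hside : ∀ i, ((⌊(x i + R) / r⌋ + 1 - ⌊(x i - R) / r⌋).toNat : ℝ) ≤ 4 * (R / r) := by
    intro i
    have hle : ⌊(x i - R) / r⌋ ≤ ⌊(x i + R) / r⌋ := by gcongr; linarith
    have hcast : ((⌊(x i + R) / r⌋ + 1 - ⌊(x i - R) / r⌋).toNat : ℝ)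
        = (⌊(x i + R) / r⌋ : ℝ) + 1 - ⌊(x i - R) / r⌋ := by
      have : ((⌊(x i + R) / r⌋ + 1 - ⌊(x i - R) / r⌋).toNat : ℤ)
        = ⌊(x i + R) / r⌋ + 1 - ⌊(x i - R) / r⌋ := Int.toNat_of_nonneg (by omega)
      exact_mod_cast this
    have h2 := Int.floor_le ((x i + R) / r)
    have h3 := Int.lt_floor_add_one ((x i - R) / r)
    have h4 : (x i + R) / r - (x i - R) / r = 2 * (R / r) := by ring
    rw [hcast]
    linarith
  rw [meshCubeCount_eq_ncard_image hr]
  have hcard := Set.ncard_le_ncard (meshIndex_image_ball_subset (R := R) hr x)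
    (Set.finite_Icc _ _)
  rw [← Finset.coe_Icc, Set.ncard_coe_finset, Pi.card_Icc] at hcard
  simp only [Int.card_Icc, Fin.prod_univ_three] at hcard
  calc ((meshIndex 3 r '' ball x R).ncard : ℝ) ≤ _ := Nat.cast_le.2 hcard
    _ ≤ (4 * (R / r)) * (4 * (R / r)) * (4 * (R / r)) := by
      push_cast
      gcongr <;> exact hside _
    _ = 64 * (R / r) ^ 3 := by ring

lemma meshCubeCount_le_of_cover {r : ℝ} (hr : 0 < r) {ι : Type*} (T : Finset ι)
    (A : ι → Set (Euc 3)) (hA : ∀ t ∈ T, ∀ x ∈ A t, ∀ y ∈ A t, dist x y ≤ 5 * r)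
    {E : Set (Euc 3)} (hE : E ⊆ ⋃ t ∈ T, A t) :
    (meshCubeCount 3 r E : ℝ) ≤ 13824 * T.card := by
  have hball : ∀ t ∈ T, ∃ c, A t ⊆ ball c (6 * r) := by
    intro t ht
    rcases (A t).eq_empty_or_nonempty with h | ⟨c, hc⟩
    · exact ⟨0, by simp [h]⟩
    · refine ⟨c, fun y hy => ?_⟩
      have := hA t ht y hy c hc
      rw [mem_ball]
      linarith
  have hbdd : Bornology.IsBounded (⋃ t ∈ T, A t) := by
    rw [Bornology.isBounded_biUnion_finset]
    intro t ht
    obtain ⟨c, hc⟩ := hball t ht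
    exact isBounded_ball.subset hc
  have hone : ∀ t ∈ T, (meshCubeCount 3 r (A t) : ℝ) ≤ 13824 := by
    intro t ht
    obtain ⟨c, hc⟩ := hball t ht
    calc (meshCubeCount 3 r (A t) : ℝ) ≤ meshCubeCount 3 r (ball c (6 * r)) :=
          Nat.cast_le.2 (meshCubeCount_mono hr hc isBounded_ball)
      _ ≤ 64 * (6 * r / r) ^ 3 := meshCubeCount_ball_le hr (by linarith) c
      _ = 13824 := by field_simp; norm_num
  calc (meshCubeCount 3 r E : ℝ) ≤ ∑ t ∈ T, (meshCubeCount 3 r (A t) : ℝ) := by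
        exact_mod_cast (meshCubeCount_mono hr hE hbdd).trans (meshCubeCount_biUnion_le hr T A)
    _ ≤ ∑ _t ∈ T, (13824 : ℝ) := Finset.sum_le_sum hone
    _ = 13824 * T.card := by rw [Finset.sum_const, nsmul_eq_mul, mul_comm]

lemma card_le_meshCubeCount {r : ℝ} (hr : 0 < r) {ι : Type*} (T : Finset ι) (f : ι → Euc 3)
    {E : Set (Euc 3)} (hE : Bornology.IsBounded E) (hf : ∀ t ∈ T, f t ∈ E)
    (hsep : ∀ s ∈ T, ∀ t ∈ T, s ≠ t → 2 * r ≤ dist (f s) (f t)) :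
    T.card ≤ meshCubeCount 3 r E := by
  rw [meshCubeCount_eq_ncard_image hr, ← Set.ncard_coe_finset]
  have hinj : Set.InjOn (fun t => meshIndex 3 r (f t)) (T : Set ι) := by
    intro s hs t ht hst
    by_contra hne
    have hd := hsep s hs t ht hne
    have hc : ∀ i, |f s i - f t i| < r := by
      intro i
      have h := Int.abs_sub_lt_one_of_floor_eq_floor (congrFun hst i)
      rw [← sub_div, abs_div, abs_of_pos hr, div_lt_one hr] at h
      exact h
    have hsq : ∀ i, (f s i - f t i) ^ 2 ≤ r ^ 2 := fun i => by
      rw [← sq_abs]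
      gcongr
      exact (hc i).le
    have h2 : dist (f s) (f t) ^ 2 ≤ 3 * r ^ 2 := by
      rw [EuclideanSpace.dist_eq, Real.sq_sqrt (by positivity)]
      simp only [Fin.sum_univ_three, Real.dist_eq, sq_abs]
      linarith [hsq 0, hsq 1, hsq 2]
    have : (2 * r) ^ 2 ≤ dist (f s) (f t) ^ 2 := by gcongr
    nlinarith
  rw [← hinj.ncard_image]
  refine Set.ncard_le_ncard ?_ (finite_meshIndex_image hr hE)
  rintro _ ⟨t, ht, rfl⟩
  exact ⟨f t, hf t ht, rfl⟩

/-- The point of `ℝ³` with signed radius `g`, azimuth `u` and polar angle `v`. -/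
def sphericalPoint (g u v : ℝ) : Euc 3 :=
  (WithLp.equiv 2 (Fin 3 → ℝ)).symm
    ![g * Real.cos u * Real.sin v, g * Real.sin u * Real.sin v, g * Real.cos v]

lemma dist_sphericalPoint_sq (g u v g' u' v' : ℝ) :
    dist (sphericalPoint g u v) (sphericalPoint g' u' v') ^ 2 =
      (g * Real.sin v) ^ 2 + (g' * Real.sin v') ^ 2
        - 2 * (g * Real.sin v) * (g' * Real.sin v') * Real.cos (u - u')
        + (g * Real.cos v - g' * Real.cos v') ^ 2 := by
  rw [EuclideanSpace.dist_eq, Real.sq_sqrt (by positivity)]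
  simp only [sphericalPoint, Fin.sum_univ_three, Real.dist_eq, sq_abs, Real.cos_sub]
  simp
  linear_combination (g * Real.sin v) ^ 2 * Real.sin_sq_add_cos_sq u
    + (g' * Real.sin v') ^ 2 * Real.sin_sq_add_cos_sq u'

lemma norm_sphericalPoint (g u v : ℝ) : ‖sphericalPoint g u v‖ = |g| := by
  rw [← sq_eq_sq₀ (norm_nonneg _) (abs_nonneg _), sq_abs, EuclideanSpace.norm_eq,
    Real.sq_sqrt (by positivity)]
  simp only [sphericalPoint, Fin.sum_univ_three, Real.norm_eq_abs, sq_abs]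
  simp
  linear_combination (g * Real.sin v) ^ 2 * Real.sin_sq_add_cos_sq u
    + g ^ 2 * Real.sin_sq_add_cos_sq v

lemma abs_abs_sub_abs_le_dist_sphericalPoint (g u v g' u' v' : ℝ) :
    |(|g| - |g'|)| ≤ dist (sphericalPoint g u v) (sphericalPoint g' u' v') := by
  have := abs_norm_sub_norm_le (sphericalPoint g u v) (sphericalPoint g' u' v')
  rwa [norm_sphericalPoint, norm_sphericalPoint, ← dist_eq_norm] at this

lemma abs_mul_sin_azimuth_le_dist (g u v g' u' v' : ℝ) :
    |g * Real.sin v| * |Real.sin (u - u')| ≤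
      dist (sphericalPoint g u v) (sphericalPoint g' u' v') := by
  refine le_of_sq_le_sq ?_ dist_nonneg
  rw [dist_sphericalPoint_sq, mul_pow, sq_abs, sq_abs, Real.sin_sq]
  nlinarith [sq_nonneg (g * Real.sin v * Real.cos (u - u') - g' * Real.sin v'),
    sq_nonneg (g * Real.cos v - g' * Real.cos v')]

lemma abs_mul_sin_polar_sub_le_dist (g u v g' u' v' : ℝ) :
    |g * Real.sin v| - |g' * Real.sin v'| ≤
      dist (sphericalPoint g u v) (sphericalPoint g' u' v') := by
  refine (le_abs_self _).trans (le_of_sq_le_sq ?_ dist_nonneg)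
  rw [dist_sphericalPoint_sq, sq_abs, sub_sq, sq_abs, sq_abs]
  have h : (g * Real.sin v) * (g' * Real.sin v') * Real.cos (u - u') ≤
      |g * Real.sin v| * |g' * Real.sin v'| := by
    rw [← abs_mul]
    refine (le_abs_self _).trans ?_
    rw [abs_mul]
    exact mul_le_of_le_one_right (abs_nonneg _) (Real.abs_cos_le_one _)
  nlinarith [sq_nonneg (g * Real.cos v - g' * Real.cos v')]

lemma mul_abs_sin_polar_le_dist {g g' v v' : ℝ} (u u' : ℝ) (hg : 0 ≤ g) (hg' : 0 ≤ g')
    (hv : 0 ≤ Real.sin v) (hv' : 0 ≤ Real.sin v') :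
    g * |Real.sin (v - v')| ≤ dist (sphericalPoint g u v) (sphericalPoint g' u' v') := by
  refine le_of_sq_le_sq ?_ dist_nonneg
  rw [dist_sphericalPoint_sq, mul_pow, sq_abs, Real.sin_sq, Real.cos_sub]
  have h : (g * Real.sin v) * (g' * Real.sin v') * Real.cos (u - u') ≤
      (g * Real.sin v) * (g' * Real.sin v') :=
    mul_le_of_le_one_right (by positivity) (Real.cos_le_one _)
  have h1 : g ^ 2 * (Real.sin v ^ 2 + Real.cos v ^ 2) = g ^ 2 := by
    rw [Real.sin_sq_add_cos_sq, mul_one]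
  have h2 : g' ^ 2 * (Real.sin v' ^ 2 + Real.cos v' ^ 2) = g' ^ 2 := by
    rw [Real.sin_sq_add_cos_sq, mul_one]
  nlinarith [sq_nonneg (g * (Real.cos v * Real.cos v' + Real.sin v * Real.sin v') - g')]

lemma dist_sphericalPoint_azimuth_le (g u v g' u' : ℝ) :
    dist (sphericalPoint g u v) (sphericalPoint g' u' v) ≤
      |g - g'| + |g * Real.sin v| * |u - u'| := by
  have h1 : dist (sphericalPoint g u v) (sphericalPoint g u' v) ≤
      |g * Real.sin v| * |u - u'| := by
    refine le_of_sq_le_sq ?_ (by positivity)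
    rw [dist_sphericalPoint_sq, mul_pow |_|, sq_abs, sq_abs]
    nlinarith [mul_le_mul_of_nonneg_left (Real.one_sub_sq_div_two_le_cos (x := u - u'))
      (sq_nonneg (g * Real.sin v))]
  have h2 : dist (sphericalPoint g u' v) (sphericalPoint g' u' v) ≤ |g - g'| := by
    refine le_of_sq_le_sq ?_ (by positivity)
    rw [dist_sphericalPoint_sq, sq_abs, sub_self, Real.cos_zero]
    apply le_of_eq
    linear_combination (g - g') ^ 2 * Real.sin_sq_add_cos_sq v
  linarith [dist_triangle (sphericalPoint g u v) (sphericalPoint g u' v)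
    (sphericalPoint g' u' v)]

lemma dist_sphericalPoint_polar {g : ℝ} (hg : 0 ≤ g) (u v v' : ℝ) :
    dist (sphericalPoint g u v) (sphericalPoint g u v') = 2 * g * |Real.sin ((v - v') / 2)| := by
  rw [← sq_eq_sq₀ dist_nonneg (by positivity), dist_sphericalPoint_sq, mul_pow _ |_|, sq_abs,
    Real.sin_sq_eq_half_sub, mul_div_cancel₀ _ (two_ne_zero' ℝ), sub_self, Real.cos_zero,
    Real.cos_sub]
  linear_combination g ^ 2 * Real.sin_sq_add_cos_sq v + g ^ 2 * Real.sin_sq_add_cos_sq v'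

lemma sphericalPoint_polar_periodic (g u v : ℝ) (m : ℤ) :
    sphericalPoint g u (v - m * (2 * Real.pi)) = sphericalPoint g u v := by
  simp [sphericalPoint, Real.sin_sub_int_mul_two_pi, Real.cos_sub_int_mul_two_pi]

lemma abs_le_two_mul_abs_sin {x : ℝ} (hx : |x| ≤ 3 / 2) : |x| ≤ 2 * |Real.sin x| := by
  have h := Real.mul_abs_le_abs_sin (x := x) (by linarith [Real.pi_gt_three])
  have h2 : (1 : ℝ) / 2 ≤ 2 / Real.pi := by
    rw [div_le_div_iff₀ two_pos Real.pi_pos]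
    linarith [Real.pi_le_four]
  nlinarith [abs_nonneg x]

lemma exists_abs_sub_int_mul_two_pi_le (x : ℝ) : ∃ m : ℤ, |x - m * (2 * Real.pi)| ≤ Real.pi := by
  refine ⟨round (x / (2 * Real.pi)), ?_⟩
  have hpi := Real.pi_pos
  have h := abs_sub_round (x / (2 * Real.pi))
  have : x - round (x / (2 * Real.pi)) * (2 * Real.pi)
      = (x / (2 * Real.pi) - round (x / (2 * Real.pi))) * (2 * Real.pi) := by
    field_simp
  rw [this, abs_mul, abs_of_pos (by positivity : 0 < 2 * Real.pi)]
  nlinarith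

lemma abs_floor_div_le {r R x : ℝ} (hr : 0 < r) (hx : |x| ≤ 7 * R) :
    ⌊x / r⌋ ∈ Finset.Icc (-(⌈7 * R / r⌉ + 1)) (⌈7 * R / r⌉ + 1) := by
  have h : |x / r| ≤ 7 * R / r := by
    rw [abs_div, abs_of_pos hr]
    gcongr
  have h1 := abs_le.1 h
  have h2 := Int.le_ceil (7 * R / r)
  rw [Finset.mem_Icc]
  constructor
  · rw [Int.le_floor]
    push_cast
    linarith
  · have : (⌊x / r⌋ : ℝ) ≤ ⌈7 * R / r⌉ := (Int.floor_le _).trans (by linarith)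
    have := Int.cast_le.1 this
    omega

lemma meshCubeCount_turn_inter_ball_le {g : ℝ → ℝ} {a : ℝ} (hg : AntitoneOn g (Icc a (a + 1)))
    (hpos : ∀ u ∈ Icc a (a + 1), 0 ≤ g u) {r R : ℝ} (hr : 0 < r) (hR : r ≤ R) (x : Euc 3) :
    (meshCubeCount 3 r
      ({y | ∃ u ∈ Icc a (a + 1), ∃ v, y = sphericalPoint (g u) u v} ∩ ball x R) : ℝ)
      ≤ 5000000 * (R / r) ^ 2 := by
  have hR0 : 0 < R := hr.trans_le hR
  have h1 : 1 ≤ R / r := (one_le_div hr).2 hR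
  rcases ({y | ∃ u ∈ Icc a (a + 1), ∃ v, y = sphericalPoint (g u) u v} ∩
    ball x R).eq_empty_or_nonempty with hE | ⟨y₀, ⟨u₀, hu₀, v₀, rfl⟩, hy₀⟩
  · rw [hE, meshCubeCount_eq_ncard_image hr, image_empty, Set.ncard_empty, Nat.cast_zero]
    positivity
  set t₀ := |g u₀ * Real.sin v₀| with ht₀
  have ht₀0 : 0 ≤ t₀ := abs_nonneg _
  let Φ : ℝ → ℝ := fun u => (t₀ + R) * u - g u
  let Q : ℝ → ℝ → Prop := fun u v => u ∈ Icc a (a + 1) ∧ sphericalPoint (g u) u v ∈ ball x R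
  have hΦ : ∀ u ∈ Icc a (a + 1), ∀ u' ∈ Icc a (a + 1),
      |Φ u - Φ u'| = (t₀ + R) * |u - u'| + |g u - g u'| := by
    have key : ∀ u ∈ Icc a (a + 1), ∀ u' ∈ Icc a (a + 1), u ≤ u' →
        |Φ u - Φ u'| = (t₀ + R) * |u - u'| + |g u - g u'| := by
      intro u hu u' hu' huu
      have hgg := hg hu hu' huu
      have hmul : (t₀ + R) * u ≤ (t₀ + R) * u' := by gcongr
      rw [abs_of_nonpos (by simp only [Φ]; linarith), abs_of_nonpos (by linarith : u - u' ≤ 0),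
        abs_of_nonneg (by linarith : 0 ≤ g u - g u')]
      simp only [Φ]
      ring
    intro u hu u' hu'
    rcases le_total u u' with h | h
    · exact key u hu u' hu' h
    · rw [abs_sub_comm, key u' hu' u hu h, abs_sub_comm u, abs_sub_comm (g u)]
  have hQdist : ∀ u v u' v', Q u v → Q u' v' →
      dist (sphericalPoint (g u) u v) (sphericalPoint (g u') u' v') ≤ 2 * R := by
    intro u v u' v' h h'
    have h2 := dist_triangle_right (sphericalPoint (g u) u v) (sphericalPoint (g u') u' v') x
    have h3 := mem_ball.1 h.2
    have h4 := mem_ball.1 h'.2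
    linarith
  have hQ₀ : Q u₀ v₀ := ⟨hu₀, hy₀⟩
  have hQΦ : ∀ u v, Q u v → |Φ u - Φ u₀| ≤ 7 * R := by
    intro u v h
    have hd := hQdist u₀ v₀ u v hQ₀ h
    have hu1 : |u - u₀| ≤ 1 := by
      rw [abs_le]
      constructor <;> linarith [h.1.1, h.1.2, hu₀.1, hu₀.2]
    have ha := (abs_mul_sin_azimuth_le_dist (g u₀) u₀ v₀ (g u) u v).trans hd
    have hs := abs_le_two_mul_abs_sin (x := u₀ - u) (by rw [abs_sub_comm]; linarith)
    have hg' := (abs_abs_sub_abs_le_dist_sphericalPoint (g u₀) u₀ v₀ (g u) u v).trans hd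
    rw [abs_of_nonneg (hpos _ hu₀), abs_of_nonneg (hpos _ h.1), abs_sub_comm] at hg'
    rw [abs_sub_comm] at hs
    rw [hΦ u h.1 u₀ hu₀]
    have h5 : t₀ * |u - u₀| ≤ t₀ * (2 * |Real.sin (u₀ - u)|) := by gcongr
    nlinarith
  have hchoose : ∀ k : ℤ, ∃ q : ℝ × ℝ, ∀ u v, Q u v → ⌊(Φ u - Φ u₀) / r⌋ = k →
      Q q.1 q.2 ∧ ⌊(Φ q.1 - Φ u₀) / r⌋ = k := by
    intro k
    by_cases h : ∃ u v, Q u v ∧ ⌊(Φ u - Φ u₀) / r⌋ = k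
    · obtain ⟨u, v, h⟩ := h
      exact ⟨(u, v), fun _ _ _ _ => h⟩
    · exact ⟨(0, 0), fun u v h1 h2 => (h ⟨u, v, h1, h2⟩).elim⟩
  choose q hq using hchoose
  have hproj : ∀ u v, Q u v → dist (sphericalPoint (g u) u v)
      (sphericalPoint (g (q ⌊(Φ u - Φ u₀) / r⌋).1) (q ⌊(Φ u - Φ u₀) / r⌋).1 v) ≤ 2 * r := by
    intro u v h
    obtain ⟨hQk, hk⟩ := hq _ u v h rfl
    set w := (q ⌊(Φ u - Φ u₀) / r⌋).1
    have hlt := Int.abs_sub_lt_one_of_floor_eq_floor hk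
    rw [← sub_div, sub_sub_sub_cancel_right, abs_div, abs_of_pos hr, div_lt_one hr, abs_sub_comm,
      hΦ u h.1 w hQk.1] at hlt
    have ht := (abs_mul_sin_polar_sub_le_dist (g u) u v (g u₀) u₀ v₀).trans
      (hQdist u v u₀ v₀ h hQ₀)
    have hd := dist_sphericalPoint_azimuth_le (g u) u v (g w) w
    have h6 : |g u * Real.sin v| * |u - w| ≤ (2 * (t₀ + R)) * |u - w| := by
      gcongr
      linarith
    nlinarith [abs_nonneg (g u - g w)]
  let A : ℤ × ℤ → Set (Euc 3) := fun t => {y | ∃ u v, y = sphericalPoint (g u) u v ∧ Q u v ∧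
    ⌊(Φ u - Φ u₀) / r⌋ = t.1 ∧ ∃ m : ℤ,
      ⌊g (q t.1).1 * (v - (q t.1).2 - m * (2 * Real.pi)) / r⌋ = t.2}
  let N : ℤ := ⌈7 * R / r⌉ + 1
  have hA : ∀ t ∈ Finset.Icc (-N) N ×ˢ Finset.Icc (-N) N, ∀ y ∈ A t, ∀ z ∈ A t,
      dist y z ≤ 5 * r := by
    rintro t - _ ⟨u, v, rfl, hQ, hk, m, hl⟩ _ ⟨u', v', rfl, hQ', hk', m', hl'⟩
    have hd := hproj u v hQ
    have hd' := hproj u' v' hQ'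
    have hQk := (hq _ u v hQ rfl).1
    rw [hk] at hd hQk
    rw [hk'] at hd'
    set w := (q t.1).1
    have hgw : 0 ≤ g w := hpos w hQk.1
    have hlt := Int.abs_sub_lt_one_of_floor_eq_floor (hl.trans hl'.symm)
    rw [← sub_div, ← mul_sub, abs_div, abs_of_pos hr, div_lt_one hr, abs_mul,
      abs_of_nonneg hgw] at hlt
    have hmid : dist (sphericalPoint (g w) w v) (sphericalPoint (g w) w v') ≤ r := by
      rw [← sphericalPoint_polar_periodic _ _ v m, ← sphericalPoint_polar_periodic _ _ v' m',
        dist_sphericalPoint_polar hgw]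
      have hs := Real.abs_sin_le_abs (x := (v - m * (2 * Real.pi) - (v' - m' * (2 * Real.pi))) / 2)
      rw [abs_div, abs_two] at hs
      have harg : v - (q t.1).2 - m * (2 * Real.pi) - (v' - (q t.1).2 - m' * (2 * Real.pi))
          = v - m * (2 * Real.pi) - (v' - m' * (2 * Real.pi)) := by ring
      rw [harg] at hlt
      nlinarith [mul_le_mul_of_nonneg_left hs hgw]
    rw [dist_comm] at hd'
    linarith [dist_triangle4 (sphericalPoint (g u) u v) (sphericalPoint (g w) w v)
      (sphericalPoint (g w) w v') (sphericalPoint (g u') u' v')]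
  have hcover : {y | ∃ u ∈ Icc a (a + 1), ∃ v, y = sphericalPoint (g u) u v} ∩ ball x R ⊆
      ⋃ t ∈ Finset.Icc (-N) N ×ˢ Finset.Icc (-N) N, A t := by
    rintro _ ⟨⟨u, hu, v, rfl⟩, hy⟩
    have hQ : Q u v := ⟨hu, hy⟩
    set k := ⌊(Φ u - Φ u₀) / r⌋ with hk
    obtain ⟨hQk, hk'⟩ := hq _ u v hQ rfl
    have hd := hproj u v hQ
    rw [← hk] at hd hQk
    set w := (q k).1
    have hgw : 0 ≤ g w := hpos w hQk.1
    obtain ⟨m, hm⟩ := exists_abs_sub_int_mul_two_pi_le (v - (q k).2)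
    have hfar : g w * |v - (q k).2 - m * (2 * Real.pi)| ≤ 7 * R := by
      have hd2 : dist (sphericalPoint (g w) w v) (sphericalPoint (g w) w (q k).2) ≤ 4 * R := by
        have h3 := hQdist u v w (q k).2 hQ hQk
        have h4 := dist_triangle_left (sphericalPoint (g w) w v)
          (sphericalPoint (g w) w (q k).2) (sphericalPoint (g u) u v)
        linarith
      rw [← sphericalPoint_polar_periodic _ _ v m, dist_sphericalPoint_polar hgw,
        sub_right_comm] at hd2
      set z := v - (q k).2 - m * (2 * Real.pi)
      have hs := Real.mul_abs_le_abs_sin (x := z / 2)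
        (by rw [abs_div, abs_two]; linarith)
      rw [abs_div, abs_two] at hs
      have hs2 : |z| ≤ Real.pi * |Real.sin (z / 2)| := by
        have := Real.pi_pos
        calc |z| = Real.pi * (2 / Real.pi * (|z| / 2)) := by field_simp
          _ ≤ _ := by gcongr
      calc g w * |z| ≤ g w * (Real.pi * |Real.sin (z / 2)|) := by gcongr
        _ = Real.pi * (2 * g w * |Real.sin (z / 2)|) / 2 := by ring
        _ ≤ 3.15 * (4 * R) / 2 := by
          gcongr
          exact Real.pi_lt_d2.le
        _ ≤ 7 * R := by linarith
    simp only [mem_iUnion]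
    refine ⟨(k, ⌊g w * (v - (q k).2 - m * (2 * Real.pi)) / r⌋), ?_, u, v, rfl, hQ, rfl, m, rfl⟩
    rw [Finset.mem_product]
    exact ⟨abs_floor_div_le hr (hQΦ u v hQ),
      abs_floor_div_le hr (by rwa [abs_mul, abs_of_nonneg hgw])⟩
  refine (meshCubeCount_le_of_cover hr _ A hA hcover).trans ?_
  have hN0 : 0 ≤ N + 1 - -N := by
    have : 0 ≤ ⌈7 * R / r⌉ := Int.ceil_nonneg (by positivity)
    simp only [N]
    omega
  have hN : (((N + 1 - -N).toNat : ℕ) : ℝ) ≤ 19 * (R / r) := by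
    have hcast : (((N + 1 - -N).toNat : ℕ) : ℝ) = ((N + 1 - -N : ℤ) : ℝ) := by
      exact_mod_cast Int.toNat_of_nonneg hN0
    have := Int.ceil_lt_add_one (7 * R / r)
    have h7 : 7 * R / r = 7 * (R / r) := by ring
    rw [hcast]
    simp only [N]
    push_cast
    linarith
  rw [Finset.card_product, Int.card_Icc]
  push_cast
  calc _ ≤ (13824 : ℝ) * ((19 * (R / r)) * (19 * (R / r))) := by gcongr
    _ ≤ 5000000 * (R / r) ^ 2 := by nlinarith [sq_nonneg (R / r)]

/-- The part of the spiral shell with spiral parameter in `[n, n + 1]`. -/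
def spiralShellTurn (p : ℝ) (n : ℕ) : Set (Euc 3) :=
  {y | ∃ u ∈ Icc (n : ℝ) (n + 1), ∃ v, y = sphericalPoint (u ^ (-p)) u v}

lemma mem_spiralShell {p : ℝ} {x : Euc 3} :
    x ∈ spiralShell p ↔ ∃ u v : ℝ, 1 ≤ u ∧ 1 ≤ v ∧ x = sphericalPoint (u ^ (-p)) u v := Iff.rfl

lemma meshCubeCount_spiralShellTurn_le {p : ℝ} (hp : 0 < p) {n : ℕ} (hn : 1 ≤ n) {r R s : ℝ}
    (hr : 0 < r) (hR : r ≤ R) (hrn : r ≤ (n : ℝ) ^ (-p)) (hs0 : 0 ≤ s) (hs2 : s ≤ 2)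
    (x : Euc 3) :
    (meshCubeCount 3 r (spiralShellTurn p n ∩ ball x R) : ℝ) ≤
      20000000 * (R ^ (2 - s) * (n : ℝ) ^ (-(p * s)) / r ^ 2) := by
  have hn1 : (1 : ℝ) ≤ n := by exact_mod_cast hn
  have hn0 : (0 : ℝ) < n := by linarith
  have hR0 : 0 < R := hr.trans_le hR
  have hanti : AntitoneOn (fun u : ℝ => u ^ (-p)) (Icc (n : ℝ) (n + 1)) := fun u hu v _ huv =>
    Real.rpow_le_rpow_of_nonpos (hn0.trans_le hu.1) huv (by linarith)
  have hpos : ∀ u ∈ Icc (n : ℝ) (n + 1), 0 ≤ u ^ (-p) := fun u hu =>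
    Real.rpow_nonneg (hn0.le.trans hu.1) _
  set G : ℝ := (n : ℝ) ^ (-p) with hG
  have hG0 : 0 < G := by positivity
  have hlocal := meshCubeCount_turn_inter_ball_le hanti hpos hr hR x
  have hglobal := meshCubeCount_turn_inter_ball_le hanti hpos hr
    (show r ≤ 2 * G by linarith) 0
  have hsub : spiralShellTurn p n ∩ ball x R ⊆ spiralShellTurn p n ∩ ball 0 (2 * G) := by
    rintro y ⟨hy, -⟩
    refine ⟨hy, ?_⟩
    obtain ⟨u, hu, v, rfl⟩ := hy
    rw [mem_ball_zero_iff, norm_sphericalPoint, abs_of_nonneg (hpos u hu)]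
    have := hanti ⟨le_rfl, by linarith⟩ hu hu.1
    simp only at this
    linarith
  have hglobal' : (meshCubeCount 3 r (spiralShellTurn p n ∩ ball x R) : ℝ) ≤
      5000000 * (2 * G / r) ^ 2 :=
    (Nat.cast_le.2 (meshCubeCount_mono hr hsub (isBounded_ball.subset inter_subset_right))).trans
      hglobal
  have hGs : (n : ℝ) ^ (-(p * s)) = G ^ s := by
    rw [hG, ← Real.rpow_mul hn0.le]
    ring_nf
  have hmin : (min R G) ^ 2 ≤ R ^ (2 - s) * G ^ s := by
    have h0 : 0 < min R G := lt_min hR0 hG0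
    calc (min R G) ^ 2 = (min R G) ^ (2 - s) * (min R G) ^ s := by
          rw [← Real.rpow_add h0, sub_add_cancel]
          norm_cast
      _ ≤ _ := by
        have := sub_nonneg.2 hs2
        gcongr
        · exact min_le_left _ _
        · exact min_le_right _ _
  rw [hGs]
  calc (meshCubeCount 3 r (spiralShellTurn p n ∩ ball x R) : ℝ)
      ≤ 20000000 * ((min R G) ^ 2 / r ^ 2) := by
        rcases min_choice R G with h | h
        · rw [h, ← div_pow]
          refine hlocal.trans ?_
          gcongr
          norm_num
        · rw [h]
          refine hglobal'.trans (le_of_eq ?_)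
          ring
    _ ≤ _ := by gcongr

lemma meshCubeCount_spiralShell_inter_ball_le {p : ℝ} (hp : 0 < p) {ε s : ℝ} (hε : 0 < ε)
    (hs0 : 0 ≤ s) (hs2 : s ≤ 2) (hps : p * s ≤ 1 + ε) :
    ∃ C : ℝ, 0 < C ∧ ∀ r R : ℝ, 0 < r → r < 1 → r ≤ R → ∀ x : Euc 3,
      (meshCubeCount 3 r (ball x R ∩ spiralShell p) : ℝ) ≤
        C * (R ^ (2 - s) * r ^ (-2 - (1 + ε - p * s) / (1 + p)) + r ^ (-3 / (1 + p))) := by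
  have hsum : Summable fun n : ℕ => (n : ℝ) ^ (-(1 + ε)) :=
    Real.summable_nat_rpow.2 (by linarith)
  set Z := ∑' n : ℕ, (n : ℝ) ^ (-(1 + ε)) with hZ
  have hZ0 : 0 ≤ Z := tsum_nonneg fun n => by positivity
  refine ⟨20000000 * Z + 512, by positivity, fun r R hr hr1 hR x => ?_⟩
  have hR0 : 0 < R := hr.trans_le hR
  have hp1 : 0 < 1 + p := by linarith
  set L : ℝ := r ^ (-1 / (1 + p)) with hL
  have hL0 : 0 < L := by positivity
  have hLp : L ^ (-p) = r ^ (p / (1 + p)) := by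
    rw [hL, ← Real.rpow_mul hr.le]
    congr 1
    field_simp
  have hrL : r ≤ L ^ (-p) := by
    rw [hLp]
    conv_lhs => rw [← Real.rpow_one r]
    apply Real.rpow_le_rpow_of_exponent_ge hr hr1.le
    rw [div_le_one hp1]
    linarith
  set ρ : ℝ := r ^ (p / (1 + p)) with hρ
  have hcover : ball x R ∩ spiralShell p ⊆
      (⋃ n ∈ Finset.Icc 1 ⌊L⌋₊, spiralShellTurn p n ∩ ball x R) ∪ ball 0 (2 * ρ) := by
    rintro y ⟨hyR, hy⟩
    obtain ⟨u, v, hu, -, rfl⟩ := mem_spiralShell.1 hy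
    have hu0 : 0 ≤ u := by linarith
    by_cases h : ⌊u⌋₊ ≤ ⌊L⌋₊
    · left
      simp only [mem_iUnion]
      exact ⟨⌊u⌋₊, Finset.mem_Icc.2 ⟨Nat.one_le_floor_iff _ |>.2 hu, h⟩,
        ⟨u, ⟨Nat.floor_le hu0, (Nat.lt_floor_add_one u).le⟩, v, rfl⟩, hyR⟩
    · right
      push Not at h
      have hLu : L < u := (Nat.floor_lt hL0.le).1 h |>.trans_le (Nat.floor_le hu0)
      rw [mem_ball_zero_iff, norm_sphericalPoint, abs_of_nonneg (by positivity)]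
      have : u ^ (-p) ≤ L ^ (-p) := Real.rpow_le_rpow_of_nonpos hL0 hLu.le (by linarith)
      have : 0 < ρ := by positivity
      linarith
  have hturn : ∀ n ∈ Finset.Icc 1 ⌊L⌋₊,
      (meshCubeCount 3 r (spiralShellTurn p n ∩ ball x R) : ℝ) ≤
        20000000 * (R ^ (2 - s) * L ^ (1 + ε - p * s) / r ^ 2) * (n : ℝ) ^ (-(1 + ε)) := by
    intro n hn
    rw [Finset.mem_Icc] at hn
    have hn0 : (0 : ℝ) < n := by exact_mod_cast hn.1
    have hnL : (n : ℝ) ≤ L := (Nat.le_floor_iff hL0.le).1 hn.2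
    have hrn : r ≤ (n : ℝ) ^ (-p) :=
      hrL.trans (Real.rpow_le_rpow_of_nonpos hn0 hnL (by linarith))
    have hpow : (n : ℝ) ^ (-(p * s)) ≤ L ^ (1 + ε - p * s) * (n : ℝ) ^ (-(1 + ε)) := by
      calc (n : ℝ) ^ (-(p * s)) = (n : ℝ) ^ (1 + ε - p * s) * (n : ℝ) ^ (-(1 + ε)) := by
            rw [← Real.rpow_add hn0]
            ring_nf
        _ ≤ _ := by
          have := sub_nonneg.2 hps
          gcongr
    refine (meshCubeCount_spiralShellTurn_le hp hn.1 hr hR hrn hs0 hs2 x).trans ?_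
    calc 20000000 * (R ^ (2 - s) * (n : ℝ) ^ (-(p * s)) / r ^ 2)
        ≤ 20000000 * (R ^ (2 - s) * (L ^ (1 + ε - p * s) * (n : ℝ) ^ (-(1 + ε))) / r ^ 2) := by
          gcongr
      _ = _ := by ring
  have hbdd : Bornology.IsBounded
      ((⋃ n ∈ Finset.Icc 1 ⌊L⌋₊, spiralShellTurn p n ∩ ball x R) ∪ ball 0 (2 * ρ)) := by
    refine Bornology.IsBounded.union ?_ isBounded_ball
    rw [Bornology.isBounded_biUnion_finset]
    exact fun n _ => isBounded_ball.subset inter_subset_right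
  have hLr : L ^ (1 + ε - p * s) / r ^ 2 = r ^ (-2 - (1 + ε - p * s) / (1 + p)) := by
    rw [hL, ← Real.rpow_mul hr.le, ← Real.rpow_natCast r 2, ← Real.rpow_sub hr]
    congr 1
    push_cast
    ring
  have hinner : (meshCubeCount 3 r (ball 0 (2 * ρ)) : ℝ) ≤ 512 * r ^ (-3 / (1 + p)) := by
    have hρ0 : 0 < ρ := by positivity
    refine (meshCubeCount_ball_le hr (by linarith) 0).trans (le_of_eq ?_)
    have : (ρ / r) ^ 3 = r ^ (-3 / (1 + p)) := by
      rw [hρ, ← Real.rpow_sub_one hr.ne', ← Real.rpow_natCast, ← Real.rpow_mul hr.le]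
      congr 1
      field_simp
      push_cast
      ring
    rw [← this]
    ring
  calc (meshCubeCount 3 r (ball x R ∩ spiralShell p) : ℝ)
      ≤ (∑ n ∈ Finset.Icc 1 ⌊L⌋₊, (meshCubeCount 3 r (spiralShellTurn p n ∩ ball x R) : ℝ))
        + meshCubeCount 3 r (ball 0 (2 * ρ)) := by
        have h1 := meshCubeCount_mono hr hcover hbdd
        have h2 := meshCubeCount_union_le hr
          (⋃ n ∈ Finset.Icc 1 ⌊L⌋₊, spiralShellTurn p n ∩ ball x R) (ball 0 (2 * ρ))
        have h3 := meshCubeCount_biUnion_le hr (Finset.Icc 1 ⌊L⌋₊)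
          (fun n => spiralShellTurn p n ∩ ball x R)
        exact_mod_cast h1.trans (h2.trans (by gcongr))
    _ ≤ (∑ n ∈ Finset.Icc 1 ⌊L⌋₊,
          20000000 * (R ^ (2 - s) * L ^ (1 + ε - p * s) / r ^ 2) * (n : ℝ) ^ (-(1 + ε)))
        + 512 * r ^ (-3 / (1 + p)) := add_le_add (Finset.sum_le_sum hturn) hinner
    _ ≤ 20000000 * (R ^ (2 - s) * L ^ (1 + ε - p * s) / r ^ 2) * Z
        + 512 * r ^ (-3 / (1 + p)) := by
        rw [← Finset.mul_sum]
        gcongr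
        exact hsum.sum_le_tsum _ fun n _ => by positivity
    _ = 20000000 * Z * (R ^ (2 - s) * (L ^ (1 + ε - p * s) / r ^ 2))
        + 512 * r ^ (-3 / (1 + p)) := by ring
    _ ≤ _ := by
      rw [hLr]
      have h1 : 0 ≤ R ^ (2 - s) * r ^ (-2 - (1 + ε - p * s) / (1 + p)) := by positivity
      have h2 : 0 ≤ r ^ (-3 / (1 + p)) := by positivity
      nlinarith [mul_nonneg hZ0 h2]

lemma regAssouadSpec_le_of_forall {d : ℕ} {θ : ℝ} {E : Set (Euc d)} {α C : ℝ} (hα : 0 < α)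
    (hC : 0 < C) (h : ∀ r R : ℝ, 0 < r → 0 < R → r ≤ R ^ (1 / θ) → R < 1 →
      ∀ x ∈ E, (meshCubeCount d r (ball x R ∩ E) : ℝ) ≤ C * (R / r) ^ α) :
    regAssouadSpec d θ E ≤ α :=
  csInf_le ⟨0, fun _ h => h.1.le⟩ ⟨hα, C, hC, h⟩

lemma le_self_of_le_rpow_one_div {θ r R : ℝ} (hθ : θ ∈ Ioo (0 : ℝ) 1) (hR : 0 < R) (hR1 : R < 1)
    (h : r ≤ R ^ (1 / θ)) : r ≤ R := by
  refine h.trans ?_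
  conv_rhs => rw [← Real.rpow_one R]
  apply Real.rpow_le_rpow_of_exponent_ge hR hR1.le
  rw [le_div_iff₀ hθ.1]
  linarith [hθ.2]

lemma meshCubeCount_inter_ball_le_rpow_three {θ : ℝ} (hθ : θ ∈ Ioo (0 : ℝ) 1) (E : Set (Euc 3))
    (r R : ℝ) (hr : 0 < r) (hR : 0 < R) (h : r ≤ R ^ (1 / θ)) (hR1 : R < 1) (x : Euc 3) :
    (meshCubeCount 3 r (ball x R ∩ E) : ℝ) ≤ 64 * (R / r) ^ (3 : ℝ) := by
  refine (Nat.cast_le.2 (meshCubeCount_mono hr inter_subset_left isBounded_ball)).trans ?_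
  have h3 : (R / r) ^ (3 : ℝ) = (R / r) ^ 3 := by exact_mod_cast Real.rpow_natCast (R / r) 3
  rw [h3]
  exact meshCubeCount_ball_le hr (le_self_of_le_rpow_one_div hθ hR hR1 h) x

lemma regAssouadSpec_le_three {θ : ℝ} (hθ : θ ∈ Ioo (0 : ℝ) 1) (E : Set (Euc 3)) :
    regAssouadSpec 3 θ E ≤ 3 :=
  regAssouadSpec_le_of_forall three_pos (by norm_num : (0 : ℝ) < 64) fun r R hr hR h hR1 x _ =>
    meshCubeCount_inter_ball_le_rpow_three hθ E r R hr hR h hR1 x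

lemma rpow_sub_one_le_div {θ r R : ℝ} (hθ : θ ∈ Ioo (0 : ℝ) 1) (hr : 0 < r) (hR : 0 < R)
    (h : r ≤ R ^ (1 / θ)) : r ^ θ ≤ R ∧ r ^ (θ - 1) ≤ R / r := by
  have h1 : r ^ θ ≤ R := by
    calc r ^ θ ≤ (R ^ (1 / θ)) ^ θ := Real.rpow_le_rpow hr.le h hθ.1.le
      _ = R := by rw [← Real.rpow_mul hR.le, one_div_mul_cancel hθ.1.ne', Real.rpow_one]
  refine ⟨h1, ?_⟩
  rw [Real.rpow_sub_one hr.ne']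
  gcongr

lemma le_of_forall_le_add_mul {x a b ε₀ : ℝ} (hε₀ : 0 < ε₀) (hb : 0 < b)
    (h : ∀ ε, 0 < ε → ε ≤ ε₀ → x ≤ a + ε * b) : x ≤ a := by
  by_contra! hlt
  have hd : 0 < (x - a) / (2 * b) := div_pos (by linarith) (by linarith)
  have h1 := h (min ε₀ ((x - a) / (2 * b))) (lt_min hε₀ hd) (min_le_left _ _)
  have h2 : min ε₀ ((x - a) / (2 * b)) * b ≤ (x - a) / (2 * b) * b := by
    gcongr
    exact min_le_right _ _
  have h3 : (x - a) / (2 * b) * b = (x - a) / 2 := by field_simp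
  linarith

lemma regAssouadSpec_spiralShell_le_of_le_half {p θ : ℝ} (hp : 0 < p) (hp2 : p ≤ 1 / 2)
    (hθ : θ ∈ Ioo (0 : ℝ) 1) :
    regAssouadSpec 3 θ (spiralShell p) ≤ 3 / ((1 + p) * (1 - θ)) := by
  have hp1 : 0 < 1 + p := by linarith
  have hθ1 : 0 < 1 - θ := by linarith [hθ.2]
  refine le_of_forall_le_add_mul one_pos (b := 1 / ((1 + p) * (1 - θ))) (by positivity) ?_
  intro ε hε _
  obtain ⟨C, hC, hcount⟩ := meshCubeCount_spiralShell_inter_ball_le hp hε zero_le_two le_rfl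
    (by linarith)
  refine regAssouadSpec_le_of_forall (C := 2 * C) (by positivity) (by positivity) ?_
  intro r R hr hR h hR1 x _
  have hrR := le_self_of_le_rpow_one_div hθ hR hR1 h
  have hr1 : r < 1 := by linarith
  have hbase := (rpow_sub_one_le_div hθ hr hR h).2
  have hpow : r ^ (-(3 + ε) / (1 + p)) ≤
      (R / r) ^ (3 / ((1 + p) * (1 - θ)) + ε * (1 / ((1 + p) * (1 - θ)))) := by
    calc r ^ (-(3 + ε) / (1 + p)) =
          (r ^ (θ - 1)) ^ (3 / ((1 + p) * (1 - θ)) + ε * (1 / ((1 + p) * (1 - θ)))) := by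
          rw [← Real.rpow_mul hr.le]
          congr 1
          field_simp
          ring
      _ ≤ _ := by gcongr
  have h1 : R ^ (2 - 2 : ℝ) * r ^ (-2 - (1 + ε - p * 2) / (1 + p)) =
      r ^ (-(3 + ε) / (1 + p)) := by
    rw [sub_self, Real.rpow_zero, one_mul]
    congr 1
    field_simp
    ring
  have h2 : r ^ (-3 / (1 + p)) ≤ r ^ (-(3 + ε) / (1 + p)) := by
    apply Real.rpow_le_rpow_of_exponent_ge hr hr1.le
    gcongr
    linarith
  calc (meshCubeCount 3 r (ball x R ∩ spiralShell p) : ℝ) ≤ _ := hcount r R hr hr1 hrR x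
    _ ≤ C * (r ^ (-(3 + ε) / (1 + p)) + r ^ (-(3 + ε) / (1 + p))) := by
      rw [h1]
      gcongr
    _ = 2 * C * r ^ (-(3 + ε) / (1 + p)) := by ring
    _ ≤ _ := by gcongr

lemma regAssouadSpec_spiralShell_le_of_half_lt {p θ : ℝ} (hp2 : 1 / 2 < p)
    (hθ : θ ∈ Ioo (0 : ℝ) 1) (hθp : θ ≤ p / (1 + p)) :
    regAssouadSpec 3 θ (spiralShell p) ≤ 2 + θ / (p * (1 - θ)) := by
  have hp : 0 < p := by linarith
  have hp1 : 0 < 1 + p := by linarith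
  have hθ0 := hθ.1
  have hθ1 : 0 < 1 - θ := by linarith [hθ.2]
  refine le_of_forall_le_add_mul (ε₀ := 2 * p - 1) (by linarith) (b := θ / (p * (1 - θ)))
    (by positivity) ?_
  intro ε hε hεp
  have hs2 : (1 + ε) / p ≤ 2 := by
    rw [div_le_iff₀ hp]
    linarith
  have hps : p * ((1 + ε) / p) = 1 + ε := by field_simp
  obtain ⟨C, hC, hcount⟩ := meshCubeCount_spiralShell_inter_ball_le hp hε
    (s := (1 + ε) / p) (by positivity) hs2 hps.le
  refine regAssouadSpec_le_of_forall (C := 2 * C) (by positivity) (by positivity) ?_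
  intro r R hr hR h hR1 x _
  have hrR := le_self_of_le_rpow_one_div hθ hR hR1 h
  have hr1 : r < 1 := by linarith
  have hRr := (rpow_sub_one_le_div hθ hr hR h).1
  set e : ℝ := 2 - (1 + ε) / p with he
  have he0 : 0 ≤ e := sub_nonneg.2 hs2
  have h1 : r ^ (-3 / (1 + p)) ≤ R ^ e * r ^ (-2 : ℝ) := by
    have hle : r ^ (p / (1 + p)) ≤ R :=
      (Real.rpow_le_rpow_of_exponent_ge hr hr1.le hθp).trans hRr
    calc r ^ (-3 / (1 + p)) ≤ r ^ (p / (1 + p) * e + -2) := by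
          apply Real.rpow_le_rpow_of_exponent_ge hr hr1.le
          have : p / (1 + p) * e + -2 = -3 / (1 + p) - ε / (1 + p) := by
            rw [he]
            field_simp
            ring
          rw [this]
          linarith [div_pos hε hp1]
      _ = (r ^ (p / (1 + p))) ^ e * r ^ (-2 : ℝ) := by
          rw [Real.rpow_add hr, Real.rpow_mul hr.le]
      _ ≤ _ := by gcongr
  have h2 : R ^ e * r ^ (-2 : ℝ) ≤
      (R / r) ^ (2 + θ / (p * (1 - θ)) + ε * (θ / (p * (1 - θ)))) := by
    have hlow : R ^ (1 - 1 / θ) ≤ R / r := by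
      rw [Real.rpow_sub hR, Real.rpow_one]
      gcongr
    have hX : 0 < R / r := by positivity
    set κ : ℝ := (1 + ε) * (θ / (p * (1 - θ))) with hκ
    have hκ0 : 0 ≤ κ := by positivity
    calc R ^ e * r ^ (-2 : ℝ) = (R / r) ^ (2 : ℝ) * (R ^ (1 - 1 / θ)) ^ κ := by
          rw [← Real.rpow_mul hR.le, Real.div_rpow hR.le hr.le, Real.rpow_neg hr.le]
          have : e = 2 + (1 - 1 / θ) * κ := by
            rw [he, hκ]
            field_simp
            ring
          rw [this, Real.rpow_add hR]
          ring
      _ ≤ (R / r) ^ (2 : ℝ) * (R / r) ^ κ := by gcongr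
      _ = _ := by
        rw [← Real.rpow_add hX, hκ]
        ring_nf
  have h3 : -2 - (1 + ε - p * ((1 + ε) / p)) / (1 + p) = -2 := by rw [hps]; ring
  calc (meshCubeCount 3 r (ball x R ∩ spiralShell p) : ℝ) ≤ _ := hcount r R hr hr1 hrR x
    _ ≤ C * (R ^ e * r ^ (-2 : ℝ) + R ^ e * r ^ (-2 : ℝ)) := by
      rw [h3]
      gcongr
    _ = 2 * C * (R ^ e * r ^ (-2 : ℝ)) := by ring
    _ ≤ _ := by gcongr

lemma mul_rpow_le_rpow_neg_sub {p u u' K : ℝ} (hp : 0 < p) (hu : 0 < u) (huu : u + 1 ≤ u')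
    (hK : u' ≤ K) : p * K ^ (-p - 1) ≤ u ^ (-p) - u' ^ (-p) := by
  have hu' : 0 < u' := by linarith
  have hq : 0 < u / u' := div_pos hu hu'
  have h1 : 1 + p / u' ≤ (u / u') ^ (-p) := by
    have hlog : Real.log (u / u') ≤ -1 / u' := by
      refine (Real.log_le_sub_one_of_pos hq).trans ?_
      rw [div_sub_one hu'.ne']
      gcongr
      linarith
    calc 1 + p / u' = -p * (-1 / u') + 1 := by ring
      _ ≤ Real.log (u / u') * -p + 1 := by nlinarith
      _ ≤ _ := by
        rw [Real.rpow_def_of_pos hq]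
        exact Real.add_one_le_exp _
  have h2 : u ^ (-p) = u' ^ (-p) * (u / u') ^ (-p) := by
    rw [← Real.mul_rpow hu'.le hq.le, mul_div_cancel₀ _ hu'.ne']
  calc p * K ^ (-p - 1) ≤ p * u' ^ (-p - 1) := by
        gcongr p * ?_
        exact Real.rpow_le_rpow_of_nonpos hu' hK (by linarith)
    _ = u' ^ (-p) * (1 + p / u') - u' ^ (-p) := by
        rw [Real.rpow_sub_one hu'.ne']
        ring
    _ ≤ _ := by
        rw [h2]
        gcongr

lemma half_mul_le_abs_sin_natCast_sub {δ : ℝ} (hδ : 0 < δ) {a b : ℕ} (ha : a * δ ≤ 1 / 2)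
    (hb : b * δ ≤ 1 / 2) (hab : a ≠ b) : δ / 2 ≤ |Real.sin (a * δ - b * δ)| := by
  have ha0 : 0 ≤ a * δ := by positivity
  have hb0 : 0 ≤ b * δ := by positivity
  have h1 := abs_le_two_mul_abs_sin (x := a * δ - b * δ)
    (by rw [abs_le]; constructor <;> linarith)
  have h2 : (1 : ℝ) ≤ |(a : ℝ) - b| := by
    have : (1 : ℤ) ≤ |(a : ℤ) - b| := Int.one_le_abs (by omega)
    exact_mod_cast this
  rw [← sub_mul, abs_mul, abs_of_pos hδ] at h1
  rw [← sub_mul]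
  nlinarith

lemma le_meshCubeCount_spiralShell {p : ℝ} (hp : 0 < p) {J : ℕ} (hJ : 1 ≤ J) {r R : ℝ}
    (hr : 0 < r) (hrJ : 2 * r ≤ p * (20 * (J : ℝ)) ^ (-p - 1)) (hR : 3 * (J : ℝ) ^ (-p) ≤ R) :
    ∃ x ∈ spiralShell p, (J : ℝ) * ((20 * (J : ℝ)) ^ (-p) / (20 * r)) ^ 2 ≤
      meshCubeCount 3 r (ball x R ∩ spiralShell p) := by
  have hJ1 : (1 : ℝ) ≤ J := by exact_mod_cast hJ
  have hJ0 : (0 : ℝ) < J := by linarith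
  have hpi3 := Real.pi_gt_three
  have hpi4 := Real.pi_le_four
  have hpi := Real.pi_lt_d2
  set G : ℝ := (20 * (J : ℝ)) ^ (-p) with hG
  have hG0 : 0 < G := by positivity
  set δ : ℝ := 10 * r / G with hδ
  have hδ0 : 0 < δ := by positivity
  have hGδ : G * δ = 10 * r := by rw [hδ]; field_simp
  set A : ℕ := ⌊1 / (2 * δ)⌋₊ + 1 with hA
  have hAlow : G / (20 * r) ≤ A := by
    have h1 : G / (20 * r) = 1 / (2 * δ) := by
      rw [hδ]
      field_simp
      norm_num
    rw [h1, hA]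
    push_cast
    exact (Nat.lt_floor_add_one _).le
  have hlt : ∀ a ∈ Finset.range A, a * δ ≤ 1 / 2 := by
    intro a ha
    have h1 : a ≤ ⌊1 / (2 * δ)⌋₊ := by
      have := Finset.mem_range.1 ha
      omega
    have h2 := (Nat.le_floor_iff (by positivity)).1 h1
    rw [le_div_iff₀ (by positivity)] at h2
    linarith
  let az : ℕ → ℕ → ℝ := fun i a => 2 * Real.pi * (J + i) + a * δ
  let f : ℕ × ℕ × ℕ → Euc 3 := fun t =>
    sphericalPoint (az t.1 t.2.1 ^ (-p)) (az t.1 t.2.1) (1 + t.2.2 * δ)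
  have haz : ∀ i ∈ Finset.range J, ∀ a ∈ Finset.range A, J ≤ az i a ∧ az i a ≤ 20 * J := by
    intro i hi a ha
    have h1 := hlt a ha
    have h2 : (i : ℝ) ≤ J := by exact_mod_cast (Finset.mem_range.1 hi).le
    have h3 : 0 ≤ a * δ := by positivity
    have h4 : (0 : ℝ) ≤ i := Nat.cast_nonneg i
    simp only [az]
    constructor <;> nlinarith
  have hrad : ∀ i ∈ Finset.range J, ∀ a ∈ Finset.range A,
      G ≤ az i a ^ (-p) ∧ az i a ^ (-p) ≤ (J : ℝ) ^ (-p) := by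
    intro i hi a ha
    obtain ⟨h1, h2⟩ := haz i hi a ha
    exact ⟨Real.rpow_le_rpow_of_nonpos (by linarith) h2 (by linarith),
      Real.rpow_le_rpow_of_nonpos hJ0 h1 (by linarith)⟩
  have hgap : ∀ i ∈ Finset.range J, ∀ a ∈ Finset.range A, ∀ i' ∈ Finset.range J,
      ∀ a' ∈ Finset.range A, i < i' → 2 * r ≤ |az i a ^ (-p) - az i' a' ^ (-p)| := by
    intro i hi a ha i' hi' a' ha' hii
    have h1 : (i : ℝ) + 1 ≤ i' := by exact_mod_cast hii
    have h2 := hlt a ha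
    have h3 : 0 ≤ a' * δ := by positivity
    have h4 : az i a + 1 ≤ az i' a' := by
      simp only [az]
      nlinarith
    exact hrJ.trans ((mul_rpow_le_rpow_neg_sub hp (hJ0.trans_le (haz i hi a ha).1) h4
      (haz i' hi' a' ha').2).trans (le_abs_self _))
  have hsin : ∀ b ∈ Finset.range A, 1 / 2 ≤ Real.sin (1 + b * δ) := by
    intro b hb
    have h1 := hlt b hb
    have h2 : 0 ≤ b * δ := by positivity
    have h3 := abs_le_two_mul_abs_sin (x := 1 + b * δ)
      (by rw [abs_of_nonneg (by linarith)]; linarith)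
    rw [abs_of_nonneg (by linarith),
      abs_of_nonneg (Real.sin_nonneg_of_nonneg_of_le_pi (by linarith) (by linarith))] at h3
    linarith
  set T := Finset.range J ×ˢ Finset.range A ×ˢ Finset.range A with hT
  refine ⟨sphericalPoint ((J : ℝ) ^ (-p)) J 1,
    mem_spiralShell.2 ⟨J, 1, hJ1, le_rfl, rfl⟩, ?_⟩
  have hmem : ∀ t ∈ T, f t ∈ ball (sphericalPoint ((J : ℝ) ^ (-p)) J 1) R ∩ spiralShell p := by
    rintro ⟨i, a, b⟩ ht
    simp only [hT, Finset.mem_product] at ht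
    obtain ⟨hi, ha, hb⟩ := ht
    have h1 := hrad i hi a ha
    have hJp : 0 < (J : ℝ) ^ (-p) := by positivity
    refine ⟨?_, mem_spiralShell.2 ⟨az i a, 1 + b * δ, hJ1.trans (haz i hi a ha).1,
      by linarith [show 0 ≤ b * δ by positivity], rfl⟩⟩
    rw [mem_ball]
    refine (dist_le_norm_add_norm _ _).trans_lt ?_
    simp only [f, norm_sphericalPoint]
    rw [abs_of_pos hJp, abs_of_pos (hG0.trans_le h1.1)]
    linarith
  have hsep : ∀ s ∈ T, ∀ t ∈ T, s ≠ t → 2 * r ≤ dist (f s) (f t) := by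
    rintro ⟨i, a, b⟩ hs ⟨i', a', b'⟩ ht hne
    simp only [hT, Finset.mem_product] at hs ht
    obtain ⟨hi, ha, hb⟩ := hs
    obtain ⟨hi', ha', hb'⟩ := ht
    have hg := hG0.trans_le (hrad i hi a ha).1
    have hg' := hG0.trans_le (hrad i' hi' a' ha').1
    by_cases hii : i = i'
    · subst hii
      by_cases hbb : b = b'
      · subst hbb
        have haa : a ≠ a' := by
          rintro rfl
          exact hne rfl
        have h1 := abs_mul_sin_azimuth_le_dist (az i a ^ (-p)) (az i a) (1 + b * δ)
          (az i a' ^ (-p)) (az i a') (1 + b * δ)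
        have h2 := half_mul_le_abs_sin_natCast_sub hδ0 (hlt a ha) (hlt a' ha') haa
        have h3 : az i a - az i a' = a * δ - a' * δ := by simp only [az]; ring
        have h4 := hsin b hb
        rw [h3, abs_mul, abs_of_pos hg, abs_of_nonneg (by linarith)] at h1
        refine le_trans ?_ h1
        calc 2 * r ≤ G * (1 / 2) * (δ / 2) := by linarith
          _ ≤ _ := by
            gcongr
            exact (hrad i hi a ha).1
      · have h1 := mul_abs_sin_polar_le_dist (v := 1 + b * δ) (v' := 1 + b' * δ)
          (az i a) (az i a') hg.le hg'.le (by linarith [hsin b hb]) (by linarith [hsin b' hb'])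
        have h2 := half_mul_le_abs_sin_natCast_sub hδ0 (hlt b hb) (hlt b' hb') hbb
        rw [add_sub_add_left_eq_sub] at h1
        refine le_trans ?_ h1
        calc 2 * r ≤ G * (δ / 2) := by linarith
          _ ≤ _ := by
            gcongr
            exact (hrad i hi a ha).1
    · have h1 := abs_abs_sub_abs_le_dist_sphericalPoint (az i a ^ (-p)) (az i a) (1 + b * δ)
          (az i' a' ^ (-p)) (az i' a') (1 + b' * δ)
      rw [abs_of_pos hg, abs_of_pos hg'] at h1
      refine le_trans ?_ h1
      rcases lt_or_gt_of_ne hii with h | h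
      · exact hgap i hi a ha i' hi' a' ha' h
      · rw [abs_sub_comm]
        exact hgap i' hi' a' ha' i hi a ha h
  have hcard := card_le_meshCubeCount hr T f (isBounded_ball.subset inter_subset_left) hmem hsep
  rw [hT, Finset.card_product, Finset.card_product, Finset.card_range, Finset.card_range] at hcard
  calc (J : ℝ) * (G / (20 * r)) ^ 2 ≤ (J : ℝ) * (A : ℝ) ^ 2 := by gcongr
    _ = ((J * (A * A) : ℕ) : ℝ) := by push_cast; ring
    _ ≤ _ := Nat.cast_le.2 hcard

lemma eventually_le_natCast_rpow (K : ℝ) {e : ℝ} (he : 0 < e) :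
    ∀ᶠ J : ℕ in atTop, K ≤ (J : ℝ) ^ e :=
  ((tendsto_rpow_atTop he).comp tendsto_natCast_atTop_atTop).eventually_ge_atTop K

lemma exponent_le_of_eventually_mul_rpow_le {a b c D : ℝ} (hc : 0 < c)
    (h : ∀ᶠ J : ℕ in atTop, c * (J : ℝ) ^ a ≤ D * (J : ℝ) ^ b) : a ≤ b := by
  by_contra! hab
  obtain ⟨J, hJ, hJ2, hJ1⟩ := (h.and ((eventually_le_natCast_rpow (D / c + 1)
    (sub_pos.2 hab)).and (eventually_ge_atTop 1))).exists
  have hJ0 : (0 : ℝ) < J := by exact_mod_cast hJ1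
  have hb : 0 < (J : ℝ) ^ b := by positivity
  have h1 : (J : ℝ) ^ a = (J : ℝ) ^ (a - b) * (J : ℝ) ^ b := by
    rw [← Real.rpow_add hJ0, sub_add_cancel]
  rw [h1, ← mul_assoc] at hJ
  have h2 := le_of_mul_le_mul_right hJ hb
  have h3 := mul_le_mul_of_nonneg_left hJ2 hc.le
  have h4 : c * (D / c + 1) = D + c := by field_simp
  linarith

lemma exponent_le_of_spiralShell_bound {p θ : ℝ} (hp : 0 < p) {α C : ℝ}
    (h : ∀ r R : ℝ, 0 < r → 0 < R → r ≤ R ^ (1 / θ) → R < 1 → ∀ x ∈ spiralShell p,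
      (meshCubeCount 3 r (ball x R ∩ spiralShell p) : ℝ) ≤ C * (R / r) ^ α)
    {β γ c₁ c₂ : ℝ} (hc₁ : 0 < c₁) (hc₂ : 0 < c₂) (hγ : 0 < γ)
    (hr : ∀ᶠ J : ℕ in atTop, 2 * (c₁ * (J : ℝ) ^ (-β)) ≤ p * (20 * (J : ℝ)) ^ (-p - 1))
    (hR : ∀ᶠ J : ℕ in atTop, 3 * (J : ℝ) ^ (-p) ≤ c₂ * (J : ℝ) ^ (-γ))
    (hrR : ∀ᶠ J : ℕ in atTop, c₂ * (J : ℝ) ^ (-γ) < 1 →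
      c₁ * (J : ℝ) ^ (-β) ≤ (c₂ * (J : ℝ) ^ (-γ)) ^ (1 / θ)) :
    1 - 2 * p + 2 * β ≤ (β - γ) * α := by
  refine exponent_le_of_eventually_mul_rpow_le (c := ((20 : ℝ) ^ (-p) / (20 * c₁)) ^ 2)
    (D := C * (c₂ / c₁) ^ α) (by positivity) ?_
  filter_upwards [hr, hR, hrR, eventually_le_natCast_rpow (c₂ + 1) hγ, eventually_ge_atTop 1]
    with J hr hR hrR hJγ hJ
  have hJ0 : (0 : ℝ) < J := by exact_mod_cast hJ
  have hR1 : c₂ * (J : ℝ) ^ (-γ) < 1 := by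
    rw [Real.rpow_neg hJ0.le, ← div_eq_mul_inv, div_lt_one (by positivity)]
    linarith
  obtain ⟨x, hx, hcount⟩ := le_meshCubeCount_spiralShell hp hJ
    (by positivity : 0 < c₁ * (J : ℝ) ^ (-β)) hr hR
  have hup := hcount.trans (h _ _ (by positivity) (by positivity) (hrR hR1) hR1 x hx)
  have hl : (J : ℝ) * ((20 * (J : ℝ)) ^ (-p) / (20 * (c₁ * (J : ℝ) ^ (-β)))) ^ 2 =
      ((20 : ℝ) ^ (-p) / (20 * c₁)) ^ 2 * (J : ℝ) ^ (1 - 2 * p + 2 * β) := by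
    have : 1 - 2 * p + 2 * β = 1 + ((-p) + (-p)) - ((-β) + (-β)) := by ring
    rw [this, Real.rpow_sub hJ0, Real.rpow_add hJ0, Real.rpow_add hJ0, Real.rpow_add hJ0,
      Real.rpow_one, Real.mul_rpow (by norm_num) hJ0.le]
    field_simp
  have hu : C * (c₂ * (J : ℝ) ^ (-γ) / (c₁ * (J : ℝ) ^ (-β))) ^ α =
      C * (c₂ / c₁) ^ α * (J : ℝ) ^ ((β - γ) * α) := by
    rw [mul_div_mul_comm, ← Real.rpow_sub hJ0, Real.mul_rpow (by positivity) (by positivity),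
      ← Real.rpow_mul hJ0.le]
    ring_nf
  rwa [hl, hu] at hup

lemma min_le_regAssouadSpec_spiralShell {p θ : ℝ} (hp : 0 < p) (hθ : θ ∈ Ioo (0 : ℝ) 1) {w : ℝ}
    (hw : ∀ α : ℝ, θ < p / (1 + p) → 3 ≤ (p + 1 - (p + 1) * θ) * α →
      1 - 2 * p + 2 * (p / θ) ≤ (p / θ - p) * α → w ≤ α) :
    min w 3 ≤ regAssouadSpec 3 θ (spiralShell p) := by
  have hp1 : 0 < 1 + p := by linarith
  have hθ0 := hθ.1
  have hrad : ∀ c : ℝ, ∀ β : ℝ, p + 1 < β → ∀ᶠ J : ℕ in atTop,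
      2 * (c * (J : ℝ) ^ (-β)) ≤ p * (20 * (J : ℝ)) ^ (-p - 1) := by
    intro c β hβ
    filter_upwards [eventually_le_natCast_rpow (2 * c / (p * 20 ^ (-p - 1))) (sub_pos.2 hβ),
      eventually_ge_atTop 1] with J hJ hJ1
    have hJ0 : (0 : ℝ) < J := by exact_mod_cast hJ1
    rw [div_le_iff₀ (by positivity)] at hJ
    rw [Real.mul_rpow (by norm_num) hJ0.le]
    calc 2 * (c * (J : ℝ) ^ (-β)) = 2 * c * (J : ℝ) ^ (-β) := by ring
      _ ≤ (J : ℝ) ^ (β - (p + 1)) * (p * 20 ^ (-p - 1)) * (J : ℝ) ^ (-β) := by gcongr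
      _ = p * 20 ^ (-p - 1) * ((J : ℝ) ^ (β - (p + 1)) * (J : ℝ) ^ (-β)) := by ring
      _ = _ := by
        rw [← Real.rpow_add hJ0, mul_assoc]
        ring_nf
  set c : ℝ := min 1 (p * 20 ^ (-p - 1) / 2) with hc
  have hc0 : 0 < c := lt_min one_pos (by positivity)
  have hradc : ∀ᶠ J : ℕ in atTop,
      2 * (c * (J : ℝ) ^ (-(p + 1))) ≤ p * (20 * (J : ℝ)) ^ (-p - 1) := by
    filter_upwards with J
    rw [Real.mul_rpow (by norm_num) (Nat.cast_nonneg J), neg_add', ← mul_assoc, ← mul_assoc]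
    have hcp : c ≤ p * 20 ^ (-p - 1) / 2 := min_le_right _ _
    exact mul_le_mul_of_nonneg_right (by linarith) (by positivity)
  refine le_csInf ⟨3, three_pos, 64, by norm_num, fun r R hr hR h hR1 x _ =>
    meshCubeCount_inter_ball_le_rpow_three hθ _ r R hr hR h hR1 x⟩ ?_
  rintro α ⟨-, C, -, h⟩
  rcases le_or_gt (p / (1 + p)) θ with hθp | hθp
  · refine (min_le_right _ _).trans ?_
    have := exponent_le_of_spiralShell_bound hp h (β := p + 1) (γ := p) (c₂ := 3) hc0 three_pos hp
      hradc (Eventually.of_forall fun J => le_rfl) ?_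
    · linarith
    · filter_upwards [eventually_ge_atTop 1] with J hJ hlt
      have hJ0 : (0 : ℝ) < J := by exact_mod_cast hJ
      calc c * (J : ℝ) ^ (-(p + 1)) ≤ 1 * (J : ℝ) ^ (-(p + 1)) := by
            gcongr
            exact min_le_left _ _
        _ = ((J : ℝ) ^ (-p)) ^ ((1 + p) / p) := by
            rw [one_mul, ← Real.rpow_mul hJ0.le]
            congr 1
            field_simp
            ring
        _ ≤ (3 * (J : ℝ) ^ (-p)) ^ ((1 + p) / p) := by
            gcongr
            linarith [show 0 < (J : ℝ) ^ (-p) by positivity]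
        _ ≤ _ := by
            apply Real.rpow_le_rpow_of_exponent_ge (by positivity) hlt.le
            rw [div_le_div_iff₀ hθ0 hp]
            rw [div_le_iff₀ hp1] at hθp
            linarith
  · refine (min_le_left _ _).trans (hw α hθp ?_ ?_)
    · rw [lt_div_iff₀ hp1] at hθp
      have := exponent_le_of_spiralShell_bound hp h (β := p + 1) (γ := (p + 1) * θ)
        (c₂ := c ^ θ) hc0 (by positivity) (by positivity) hradc ?_ ?_
      · linarith
      · filter_upwards [eventually_le_natCast_rpow (3 / c ^ θ)
          (by linarith : 0 < p - (p + 1) * θ), eventually_ge_atTop 1] with J hJ hJ1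
        have hJ0 : (0 : ℝ) < J := by exact_mod_cast hJ1
        rw [div_le_iff₀ (by positivity)] at hJ
        calc 3 * (J : ℝ) ^ (-p) ≤ (J : ℝ) ^ (p - (p + 1) * θ) * c ^ θ * (J : ℝ) ^ (-p) := by
              gcongr
          _ = c ^ θ * ((J : ℝ) ^ (p - (p + 1) * θ) * (J : ℝ) ^ (-p)) := by ring
          _ = _ := by
            rw [← Real.rpow_add hJ0]
            ring_nf
      · filter_upwards [eventually_ge_atTop 1] with J hJ _
        have hJ0 : (0 : ℝ) < J := by exact_mod_cast hJ
        rw [← neg_mul, Real.rpow_mul hJ0.le, ← Real.mul_rpow hc0.le (by positivity),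
          ← Real.rpow_mul (by positivity), mul_one_div_cancel hθ0.ne', Real.rpow_one]
    · refine exponent_le_of_spiralShell_bound hp h (β := p / θ) (γ := p) (c₁ := 3 ^ (1 / θ))
        (c₂ := 3) (by positivity) three_pos hp (hrad _ _ ?_)
        (Eventually.of_forall fun J => le_rfl) ?_
      · rw [lt_div_iff₀ hp1] at hθp
        rw [lt_div_iff₀ hθ0]
        linarith
      · filter_upwards [eventually_ge_atTop 1] with J hJ _
        have hJ0 : (0 : ℝ) < J := by exact_mod_cast hJ
        rw [Real.mul_rpow (by norm_num) (by positivity), ← Real.rpow_mul hJ0.le, mul_one_div,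
          neg_div]


/-- **Theorem (regularized Assouad spectrum of polynomial spiral shells).**
For `p > 0` and `θ ∈ (0,1)`: if `p ≤ 1/2` then
`dim_{A,reg}^θ 𝒮_p = min (3/((1+p)(1-θ))) 3`, and if `p > 1/2` then
`dim_{A,reg}^θ 𝒮_p = min (2 + θ/(p(1-θ))) 3`. -/
theorem regAssouadSpec_spiralShell (p : ℝ) (hp : 0 < p) :
    ∀ θ : ℝ, θ ∈ Ioo (0 : ℝ) 1 →
      (p ≤ 1 / 2 →
        regAssouadSpec 3 θ (spiralShell p) = min (3 / ((1 + p) * (1 - θ))) 3) ∧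
      (1 / 2 < p →
        regAssouadSpec 3 θ (spiralShell p) = min (2 + θ / (p * (1 - θ))) 3) := by
  intro θ hθ
  have hθ0 := hθ.1
  have hθ1 : 0 < 1 - θ := by linarith [hθ.2]
  have hp1 : 0 < 1 + p := by linarith
  constructor
  · intro hp2
    refine le_antisymm (le_min (regAssouadSpec_spiralShell_le_of_le_half hp hp2 hθ)
      (regAssouadSpec_le_three hθ _)) (min_le_regAssouadSpec_spiralShell hp hθ ?_)
    intro α _ h _
    rw [div_le_iff₀ (by positivity)]
    linarith
  · intro hp2
    refine le_antisymm ?_ (min_le_regAssouadSpec_spiralShell hp hθ ?_)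
    · rcases le_total θ (p / (1 + p)) with hθp | hθp
      · exact le_min (regAssouadSpec_spiralShell_le_of_half_lt hp2 hθ hθp)
          (regAssouadSpec_le_three hθ _)
      · refine (regAssouadSpec_le_three hθ _).trans (le_min ?_ le_rfl)
        rw [div_le_iff₀ hp1] at hθp
        have : 1 ≤ θ / (p * (1 - θ)) := by
          rw [one_le_div (by positivity)]
          linarith
        linarith
    · intro α _ _ h
      have hpos : 0 < p / θ - p := by
        rw [sub_pos, lt_div_iff₀ hθ0]
        nlinarith [hθ.2]
      refine le_of_mul_le_mul_left (le_trans (le_of_eq ?_) h) hpos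
      field_simp
      ring
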